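/- Let Σ be a submanifold of (M,η) with an almost Kähler–Poisson structure of characteristic function γ². Then for every X ∈ TΣ it holds that (∇̂_i N_A^k) X_k = N_A^l (∇̂^k Π_{il}) X_k, and consequently ∇̂_k N_A^k = N_A^l (∇̂^i Π_{il}). -/

import Mathlib

open scoped BigOperators

namespace KP

/-- Partial derivative of a real-valued function on `ℝ^k` in the `a`-th coordinate
direction. -/
noncomputable def pd {k : ℕ} (a : Fin k) (f : (Fin k → ℝ) → ℝ) (p : Fin k → ℝ) : ℝ :=
  fderiv ℝ f p (Pi.single a 1)

variable {n m : ℕ}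

/-- The Poisson bracket `{f,g} = θ^{ab} (∂_a f)(∂_b g)` associated to a bivector `θ`. -/
noncomputable def pbr (θ : (Fin n → ℝ) → Fin n → Fin n → ℝ)
    (f g : (Fin n → ℝ) → ℝ) (p : Fin n → ℝ) : ℝ :=
  ∑ a, ∑ b, θ p a b * pd a f p * pd b g p

/-- Antisymmetry of a bivector. -/
def Antisymm (θ : (Fin n → ℝ) → Fin n → Fin n → ℝ) : Prop :=
  ∀ p a b, θ p a b = - θ p b a

/-- The Jacobi identity for a bivector `θ` (so that `θ` is a Poisson bivector). -/
def JacobiId (θ : (Fin n → ℝ) → Fin n → Fin n → ℝ) : Prop :=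
  ∀ p a b c, ∑ d, (θ p a d * pd d (fun q => θ q b c) p
    + θ p b d * pd d (fun q => θ q c a) p
    + θ p c d * pd d (fun q => θ q a b) p) = 0

/-- Smoothness of a field with two indices. -/
def Smooth2 {k l k' : ℕ} (f : (Fin k → ℝ) → Fin l → Fin k' → ℝ) : Prop :=
  ∀ i j, ContDiff ℝ (⊤ : ℕ∞) fun q => f q i j

/-- A Riemannian metric `g` in local coordinates, with given inverse `gi`:
smoothness, symmetry, positive definiteness and the inverse property. -/
def IsMetric {k : ℕ} (g gi : (Fin k → ℝ) → Fin k → Fin k → ℝ) : Prop :=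
  Smooth2 g ∧
  (∀ q i j, g q i j = g q j i) ∧
  (∀ (q : Fin k → ℝ) (v : Fin k → ℝ), v ≠ 0 → 0 < ∑ i, ∑ j, g q i j * v i * v j) ∧
  (∀ q i j, (∑ l, g q i l * gi q l j) = if i = j then (1:ℝ) else 0)

/-- Christoffel symbols `Γ^a_{bc}` of the Levi-Civita connection of the metric `g`
(with inverse `gi`). -/
noncomputable def Chr {k : ℕ} (g gi : (Fin k → ℝ) → Fin k → Fin k → ℝ)
    (q : Fin k → ℝ) (a b c : Fin k) : ℝ :=
  (1/2) * ∑ d, gi q a d *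
    (pd b (fun r => g r d c) q + pd c (fun r => g r d b) q - pd d (fun r => g r b c) q)

/-- The Riemann curvature tensor `R^a_{bcd}` of the Levi-Civita connection of `g`,
with the convention `R(e_c, e_d) e_b = R^a_{bcd} e_a`. -/
noncomputable def Riem {k : ℕ} (g gi : (Fin k → ℝ) → Fin k → Fin k → ℝ)
    (q : Fin k → ℝ) (a b c d : Fin k) : ℝ :=
  pd c (fun r => Chr g gi r a d b) q - pd d (fun r => Chr g gi r a c b) q
  + ∑ e, (Chr g gi q a c e * Chr g gi q e d b - Chr g gi q a d e * Chr g gi q e c b)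

/-- The fully lowered curvature tensor `R_{abcd} = g_{ae} R^e_{bcd}`, so that
`R(X,Y,Z,V) = g(R(Z,V)Y, X) = R_{abcd} X^a Y^b Z^c V^d`. -/
noncomputable def RiemL {k : ℕ} (g gi : (Fin k → ℝ) → Fin k → Fin k → ℝ)
    (q : Fin k → ℝ) (a b c d : Fin k) : ℝ :=
  ∑ e, g q a e * Riem g gi q e b c d

/-- The induced metric `g_{ab} = η_{ij} (∂_a x^i)(∂_b x^j)` on the submanifold `Σ`
embedded via `x` in `(M,η)`. -/
noncomputable def ind (η : (Fin m → ℝ) → Fin m → Fin m → ℝ)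
    (x : (Fin n → ℝ) → Fin m → ℝ) (p : Fin n → ℝ) (a b : Fin n) : ℝ :=
  ∑ i, ∑ j, η (x p) i j * pd a (fun q => x q i) p * pd b (fun q => x q j) p

/-- Smoothness of the embedding. -/
def SmoothEmb (x : (Fin n → ℝ) → Fin m → ℝ) : Prop :=
  ∀ i, ContDiff ℝ (⊤ : ℕ∞) fun q => x q i

/-- `θ` is an almost Kähler–Poisson structure on `Σ` (with induced metric of inverse
`gi`) with characteristic function `γ2`:  `θ` is a smooth Poisson bivector, `γ2` is
smooth and strictly positive, and `γ² g^{ab} = θ^{ap} θ^{bq} g_{pq}`. -/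
def IsAKP (η : (Fin m → ℝ) → Fin m → Fin m → ℝ) (x : (Fin n → ℝ) → Fin m → ℝ)
    (θ : (Fin n → ℝ) → Fin n → Fin n → ℝ) (γ2 : (Fin n → ℝ) → ℝ)
    (gi : (Fin n → ℝ) → Fin n → Fin n → ℝ) : Prop :=
  Antisymm θ ∧ JacobiId θ ∧ Smooth2 θ ∧ Smooth2 gi ∧
  ContDiff ℝ (⊤ : ℕ∞) γ2 ∧ (∀ p, 0 < γ2 p) ∧
  (∀ p a b, (∑ c, ind η x p a c * gi p c b) = if a = b then (1:ℝ) else 0) ∧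
  (∀ p a b, γ2 p * gi p a b = ∑ c, ∑ d, θ p a c * θ p b d * ind η x p c d)

/-- `P^{ij} = {x^i, x^j}`. -/
noncomputable def Pbig (x : (Fin n → ℝ) → Fin m → ℝ)
    (θ : (Fin n → ℝ) → Fin n → Fin n → ℝ) (p : Fin n → ℝ) (i j : Fin m) : ℝ :=
  pbr θ (fun q => x q i) (fun q => x q j) p

/-- The map `P : TM → TM`, `P(X)^i = P^{ij} η_{jk} X^k`. -/
noncomputable def Pmap (η : (Fin m → ℝ) → Fin m → Fin m → ℝ)
    (x : (Fin n → ℝ) → Fin m → ℝ) (θ : (Fin n → ℝ) → Fin n → Fin n → ℝ)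
    (p : Fin n → ℝ) (X : Fin m → ℝ) (i : Fin m) : ℝ :=
  ∑ j, ∑ k, Pbig x θ p i j * η (x p) j k * X k

/-- `D^i(u) = γ^{-2} {u, x^k}{x^i, x^l} η_{kl}`. -/
noncomputable def Dop (η : (Fin m → ℝ) → Fin m → Fin m → ℝ)
    (x : (Fin n → ℝ) → Fin m → ℝ) (θ : (Fin n → ℝ) → Fin n → Fin n → ℝ)
    (γ2 : (Fin n → ℝ) → ℝ) (u : (Fin n → ℝ) → ℝ) (p : Fin n → ℝ) (i : Fin m) : ℝ :=
  (γ2 p)⁻¹ * ∑ k, ∑ l, pbr θ u (fun q => x q k) p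
    * pbr θ (fun q => x q i) (fun q => x q l) p * η (x p) k l

/-- `D^{ik} = D^i(x^k)`. -/
noncomputable def Dmat (η : (Fin m → ℝ) → Fin m → Fin m → ℝ)
    (x : (Fin n → ℝ) → Fin m → ℝ) (θ : (Fin n → ℝ) → Fin n → Fin n → ℝ)
    (γ2 : (Fin n → ℝ) → ℝ) (p : Fin n → ℝ) (i k : Fin m) : ℝ :=
  Dop η x θ γ2 (fun q => x q k) p i

/-- `Π^{ij} = η^{ij} − D^{ij}`, the projection onto the normal space. -/
noncomputable def PiU (η ηi : (Fin m → ℝ) → Fin m → Fin m → ℝ)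
    (x : (Fin n → ℝ) → Fin m → ℝ) (θ : (Fin n → ℝ) → Fin n → Fin n → ℝ)
    (γ2 : (Fin n → ℝ) → ℝ) (p : Fin n → ℝ) (i j : Fin m) : ℝ :=
  ηi (x p) i j - Dmat η x θ γ2 p i j

/-- The lowered projection `Π_{ij} = η_{ij} − D_{ij}`. -/
noncomputable def PiL (η : (Fin m → ℝ) → Fin m → Fin m → ℝ)
    (x : (Fin n → ℝ) → Fin m → ℝ) (θ : (Fin n → ℝ) → Fin n → Fin n → ℝ)
    (γ2 : (Fin n → ℝ) → ℝ) (p : Fin n → ℝ) (i j : Fin m) : ℝ :=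
  η (x p) i j - ∑ k, ∑ l, η (x p) i k * η (x p) j l * Dmat η x θ γ2 p k l

/-- The ambient components `X^i = c^a ∂_a x^i` of the tangent field with coefficient
functions `c`. -/
noncomputable def tv (x : (Fin n → ℝ) → Fin m → ℝ) (c : (Fin n → ℝ) → Fin n → ℝ)
    (p : Fin n → ℝ) (i : Fin m) : ℝ :=
  ∑ a, c p a * pd a (fun q => x q i) p

/-- Lowering an ambient index along `Σ` : `V_i = η_{ij} V^j`. -/
noncomputable def low (η : (Fin m → ℝ) → Fin m → Fin m → ℝ)
    (x : (Fin n → ℝ) → Fin m → ℝ) (V : (Fin n → ℝ) → Fin m → ℝ)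
    (p : Fin n → ℝ) (i : Fin m) : ℝ :=
  ∑ j, η (x p) i j * V p j

/-- The ambient inner product `η(V,W)` along `Σ`. -/
noncomputable def ipM (η : (Fin m → ℝ) → Fin m → Fin m → ℝ)
    (x : (Fin n → ℝ) → Fin m → ℝ) (V W : (Fin n → ℝ) → Fin m → ℝ)
    (p : Fin n → ℝ) : ℝ :=
  ∑ i, ∑ j, η (x p) i j * V p i * W p j

/-- The ambient covariant derivative `(∇̄_{e_a} V)^i` of an ambient-vector field `V`
along `Σ`. -/
noncomputable def barD (η ηi : (Fin m → ℝ) → Fin m → Fin m → ℝ)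
    (x : (Fin n → ℝ) → Fin m → ℝ) (V : (Fin n → ℝ) → Fin m → ℝ)
    (p : Fin n → ℝ) (a : Fin n) (i : Fin m) : ℝ :=
  pd a (fun q => V q i) p
    + ∑ k, ∑ l, Chr η ηi (x p) i k l * pd a (fun q => x q k) p * V p l

/-- `∇̂^i u = D^i(u)` on scalars. -/
noncomputable def nhS (η : (Fin m → ℝ) → Fin m → Fin m → ℝ)
    (x : (Fin n → ℝ) → Fin m → ℝ) (θ : (Fin n → ℝ) → Fin n → Fin n → ℝ)
    (γ2 : (Fin n → ℝ) → ℝ) (u : (Fin n → ℝ) → ℝ) (p : Fin n → ℝ) (i : Fin m) : ℝ :=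
  Dop η x θ γ2 u p i

/-- `∇̂^i V^j = D^i(V^j) + D^{ik} Γ̄^j_{kl} V^l` for ambient-vector fields `V` along `Σ`. -/
noncomputable def nhV (η ηi : (Fin m → ℝ) → Fin m → Fin m → ℝ)
    (x : (Fin n → ℝ) → Fin m → ℝ) (θ : (Fin n → ℝ) → Fin n → Fin n → ℝ)
    (γ2 : (Fin n → ℝ) → ℝ) (V : (Fin n → ℝ) → Fin m → ℝ)
    (p : Fin n → ℝ) (i j : Fin m) : ℝ :=
  Dop η x θ γ2 (fun q => V q j) p i
    + ∑ k, ∑ l, Dmat η x θ γ2 p i k * Chr η ηi (x p) j k l * V p l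

/-- `∇̂^i T^{jk}` for `2`-contravariant tensor fields `T` along `Σ`. -/
noncomputable def nhT2 (η ηi : (Fin m → ℝ) → Fin m → Fin m → ℝ)
    (x : (Fin n → ℝ) → Fin m → ℝ) (θ : (Fin n → ℝ) → Fin n → Fin n → ℝ)
    (γ2 : (Fin n → ℝ) → ℝ) (T : (Fin n → ℝ) → Fin m → Fin m → ℝ)
    (p : Fin n → ℝ) (i j k : Fin m) : ℝ :=
  Dop η x θ γ2 (fun q => T q j k) p i
    + ∑ l, ∑ l', Dmat η x θ γ2 p i l * Chr η ηi (x p) j l l' * T p l' k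
    + ∑ l, ∑ l', Dmat η x θ γ2 p i l * Chr η ηi (x p) k l l' * T p j l'

/-- `∇̂^i T_{jk}` for `2`-covariant tensor fields `T` along `Σ`. -/
noncomputable def nhT02 (η ηi : (Fin m → ℝ) → Fin m → Fin m → ℝ)
    (x : (Fin n → ℝ) → Fin m → ℝ) (θ : (Fin n → ℝ) → Fin n → Fin n → ℝ)
    (γ2 : (Fin n → ℝ) → ℝ) (T : (Fin n → ℝ) → Fin m → Fin m → ℝ)
    (p : Fin n → ℝ) (i j k : Fin m) : ℝ :=
  Dop η x θ γ2 (fun q => T q j k) p i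
    - ∑ l, ∑ l', Dmat η x θ γ2 p i l * Chr η ηi (x p) l' l j * T p l' k
    - ∑ l, ∑ l', Dmat η x θ γ2 p i l * Chr η ηi (x p) l' l k * T p j l'

/-- The second fundamental form `α(X,Y) = Π(∇̂_X Y)` (ambient components) for tangent
fields with coefficients `c`, `d`. -/
noncomputable def sff (η ηi : (Fin m → ℝ) → Fin m → Fin m → ℝ)
    (x : (Fin n → ℝ) → Fin m → ℝ) (θ : (Fin n → ℝ) → Fin n → Fin n → ℝ)
    (γ2 : (Fin n → ℝ) → ℝ) (c d : (Fin n → ℝ) → Fin n → ℝ)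
    (p : Fin n → ℝ) (i : Fin m) : ℝ :=
  ∑ j, ((if i = j then (1:ℝ) else 0) - ∑ k, Dmat η x θ γ2 p i k * η (x p) k j)
    * (∑ a, c p a * barD η ηi x (tv x d) p a j)

/-- `B_A^{ij} = −γ² ∇̂^i N_A^j`. -/
noncomputable def Bmap (η ηi : (Fin m → ℝ) → Fin m → Fin m → ℝ)
    (x : (Fin n → ℝ) → Fin m → ℝ) (θ : (Fin n → ℝ) → Fin n → Fin n → ℝ)
    (γ2 : (Fin n → ℝ) → ℝ) (N : (Fin n → ℝ) → Fin m → ℝ)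
    (p : Fin n → ℝ) (i j : Fin m) : ℝ :=
  - γ2 p * nhV η ηi x θ γ2 N p i j

/-- `N` is a smooth orthonormal frame of the normal bundle `TΣ^⊥` :
each `N_A` is a smooth unit normal field, they are mutually orthonormal, and they
are complete, i.e. `Σ_A N_A^i N_A^j = η^{ij} − D^{ij} = Π^{ij}`. -/
def NormalFrame {r : ℕ} (η ηi : (Fin m → ℝ) → Fin m → Fin m → ℝ)
    (x : (Fin n → ℝ) → Fin m → ℝ) (θ : (Fin n → ℝ) → Fin n → Fin n → ℝ)
    (γ2 : (Fin n → ℝ) → ℝ) (N : Fin r → (Fin n → ℝ) → Fin m → ℝ) : Prop :=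
  (∀ A i, ContDiff ℝ (⊤ : ℕ∞) fun q => N A q i) ∧
  (∀ A B p, ipM η x (N A) (N B) p = if A = B then (1:ℝ) else 0) ∧
  (∀ A p a, (∑ i, ∑ j, η (x p) i j * N A p i * pd a (fun q => x q j) p) = 0) ∧
  (∀ p i j, (∑ A, N A p i * N A p j) = PiU η ηi x θ γ2 p i j)


lemma pd_mul' {k : ℕ} (a : Fin k) {f g : (Fin k → ℝ) → ℝ} {p : Fin k → ℝ}
    (hf : DifferentiableAt ℝ f p) (hg : DifferentiableAt ℝ g p) :
    pd a (fun q => f q * g q) p = pd a f p * g p + f p * pd a g p := by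
  unfold pd
  rw [fderiv_fun_mul hf hg]
  simp
  ring

lemma pd_sub' {k : ℕ} (a : Fin k) {f g : (Fin k → ℝ) → ℝ} {p : Fin k → ℝ}
    (hf : DifferentiableAt ℝ f p) (hg : DifferentiableAt ℝ g p) :
    pd a (fun q => f q - g q) p = pd a f p - pd a g p := by
  unfold pd
  rw [fderiv_fun_sub hf hg]
  simp

lemma pd_sum' {k : ℕ} {ι : Type*} [Fintype ι] (a : Fin k) {f : ι → (Fin k → ℝ) → ℝ}
    {p : Fin k → ℝ} (hf : ∀ i, DifferentiableAt ℝ (f i) p) :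
    pd a (fun q => ∑ i, f i q) p = ∑ i, pd a (f i) p := by
  unfold pd
  rw [fderiv_fun_sum (fun i _ => hf i)]
  simp

lemma pd_comp' {n m : ℕ} (a : Fin n) {h : (Fin m → ℝ) → ℝ} {x : (Fin n → ℝ) → Fin m → ℝ}
    {p : Fin n → ℝ} (hh : DifferentiableAt ℝ h (x p))
    (hx : ∀ i, DifferentiableAt ℝ (fun q => x q i) p) :
    pd a (fun q => h (x q)) p = ∑ k, pd k h (x p) * pd a (fun q => x q k) p := by
  unfold pd
  have hx' : DifferentiableAt ℝ x p := differentiableAt_pi.2 hx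
  have h1 : fderiv ℝ (fun q => h (x q)) p = (fderiv ℝ h (x p)).comp (fderiv ℝ x p) :=
    fderiv_comp p hh hx'
  have h2 : ∀ k, fderiv ℝ (fun q => x q k) p (Pi.single a 1) = fderiv ℝ x p (Pi.single a 1) k := by
    intro k
    rw [fderiv_pi (φ := fun k q => x q k) hx]
    simp
  rw [h1]
  simp only [h2, ContinuousLinearMap.comp_apply]
  generalize fderiv ℝ x p (Pi.single a 1) = v
  conv_lhs => rw [pi_eq_sum_univ' v]
  simp [map_sum, mul_comm]

lemma pd_contDiff {k : ℕ} (a : Fin k) {f : (Fin k → ℝ) → ℝ}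
    (hf : ContDiff ℝ (⊤ : ℕ∞) f) : ContDiff ℝ (⊤ : ℕ∞) (pd a f) := by
  unfold pd
  exact (hf.fderiv_right (m := (⊤ : ℕ∞)) le_rfl).clm_apply contDiff_const

lemma pd_comm' {k : ℕ} (a b : Fin k) {f : (Fin k → ℝ) → ℝ} (p : Fin k → ℝ)
    (hf : ContDiff ℝ (⊤ : ℕ∞) f) : pd a (pd b f) p = pd b (pd a f) p := by
  have hd : DifferentiableAt ℝ (fderiv ℝ f) p :=
    ((hf.fderiv_right (m := (⊤ : ℕ∞)) le_rfl).differentiable (by simp)).differentiableAt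
  have h : ∀ a b : Fin k, pd a (pd b f) p
      = fderiv ℝ (fderiv ℝ f) p (Pi.single a 1) (Pi.single b 1) := by
    intro a b
    unfold pd
    rw [fderiv_clm_apply hd (differentiableAt_const _)]
    simp
  rw [h, h]
  exact (hf.contDiffAt.isSymmSndFDerivAt (by
    simp only [minSmoothness_of_isRCLikeNormedField]
    exact WithTop.coe_le_coe.2 (le_top : (2 : ℕ∞) ≤ ⊤))) _ _

/-- The pointwise linear algebra behind the two identities. -/
lemma alg_one {n m : ℕ} (e B W : Matrix (Fin n) (Fin m) ℝ) (H : Matrix (Fin m) (Fin m) ℝ)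
    (gi : Matrix (Fin n) (Fin n) ℝ) (hH : H.transpose = H) (hgi : gi.transpose = gi)
    (hg : gi * (e * H * e.transpose) = 1)
    (hS : (B * H * e.transpose).transpose = B * H * e.transpose)
    (hW : W = B * (H * e.transpose * gi * e * H)) :
    H * e.transpose * gi * B * H * e.transpose = W.transpose * gi * (e * H * e.transpose) := by
  rw [Matrix.mul_assoc W.transpose, hg, Matrix.mul_one, hW]
  simp only [Matrix.transpose_mul, Matrix.transpose_transpose, hH, hgi] at hS ⊢
  simp only [Matrix.mul_assoc] at hS ⊢
  rw [hS]

lemma alg_two {n m : ℕ} (e B W : Matrix (Fin n) (Fin m) ℝ) (H : Matrix (Fin m) (Fin m) ℝ)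
    (gi : Matrix (Fin n) (Fin n) ℝ)
    (hg : gi * (e * H * e.transpose) = 1)
    (hW : W = B * (H * e.transpose * gi * e * H)) :
    (H * e.transpose * gi * B).trace = (e.transpose * gi * W).trace := by
  have h1 : (e.transpose * gi * W).trace
      = ((gi * B * H * e.transpose) * (gi * (e * H * e.transpose))).trace := by
    rw [hW, Matrix.mul_assoc, Matrix.trace_mul_comm]
    simp only [Matrix.mul_assoc]
  rw [h1, hg, Matrix.mul_one, Matrix.mul_assoc (H * e.transpose), Matrix.trace_mul_comm]
  simp only [Matrix.mul_assoc]

lemma alg_three {m : ℕ} (A H E dE dH : Matrix (Fin m) (Fin m) ℝ) (v dv : Fin m → ℝ)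
    (hdH : dH = A.transpose * H + H * A) (hE : E.mulVec v = 0)
    (hdE : dE.mulVec v = - E.mulVec dv) :
    (dH - dE - A.transpose * (H - E) - (H - E) * A).mulVec v = E.mulVec (dv + A.mulVec v) := by
  have h : dH - dE - A.transpose * (H - E) - (H - E) * A = A.transpose * E + E * A - dE := by
    rw [hdH]; simp only [Matrix.mul_sub, Matrix.sub_mul]; abel
  rw [h, Matrix.sub_mulVec, Matrix.add_mulVec, hdE, ← Matrix.mulVec_mulVec, hE,
    ← Matrix.mulVec_mulVec, Matrix.mulVec_add]
  simp [add_comm]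

/-- The Jacobian of the embedding. -/
noncomputable def em (x : (Fin n → ℝ) → Fin m → ℝ) (p : Fin n → ℝ) :
    Matrix (Fin n) (Fin m) ℝ := Matrix.of fun a i => pd a (fun q => x q i) p

/-- The ambient metric as a matrix. -/
noncomputable def Hm (η : (Fin m → ℝ) → Fin m → Fin m → ℝ)
    (x : (Fin n → ℝ) → Fin m → ℝ) (p : Fin n → ℝ) :
    Matrix (Fin m) (Fin m) ℝ := Matrix.of (η (x p))

/-- The connection matrix. -/
noncomputable def Am (η ηi : (Fin m → ℝ) → Fin m → Fin m → ℝ)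
    (x : (Fin n → ℝ) → Fin m → ℝ) (p : Fin n → ℝ) (a : Fin n) :
    Matrix (Fin m) (Fin m) ℝ :=
  Matrix.of fun i l => ∑ k, pd a (fun q => x q k) p * Chr η ηi (x p) i k l

/-- The tangential projection. -/
noncomputable def Em (η : (Fin m → ℝ) → Fin m → Fin m → ℝ)
    (x : (Fin n → ℝ) → Fin m → ℝ) (gi : (Fin n → ℝ) → Fin n → Fin n → ℝ) (p : Fin n → ℝ) :
    Matrix (Fin m) (Fin m) ℝ :=
  Hm η x p * (em x p).transpose * Matrix.of (gi p) * em x p * Hm η x p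

lemma ind_eq (η : (Fin m → ℝ) → Fin m → Fin m → ℝ) (x : (Fin n → ℝ) → Fin m → ℝ)
    (p : Fin n → ℝ) : Matrix.of (ind η x p) = em x p * Hm η x p * (em x p).transpose := by
  ext a b
  simp only [ind, em, Hm, Matrix.mul_apply, Matrix.of_apply, Matrix.transpose_apply,
    Finset.sum_mul]
  rw [Finset.sum_comm]
  refine Finset.sum_congr rfl fun i _ => Finset.sum_congr rfl fun j _ => ?_
  ring

lemma gi_eq {η : (Fin m → ℝ) → Fin m → Fin m → ℝ} {x : (Fin n → ℝ) → Fin m → ℝ}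
    {θ : (Fin n → ℝ) → Fin n → Fin n → ℝ} {γ2 : (Fin n → ℝ) → ℝ}
    {gi : (Fin n → ℝ) → Fin n → Fin n → ℝ} (hakp : IsAKP η x θ γ2 gi) (p : Fin n → ℝ) :
    Matrix.of (gi p) = (γ2 p)⁻¹ • (Matrix.of (θ p) * (em x p * Hm η x p * (em x p).transpose)
      * (Matrix.of (θ p)).transpose) := by
  obtain ⟨-, -, -, -, -, hpos, -, h⟩ := hakp
  rw [← ind_eq]
  ext a b
  have h0 := (hpos p).ne'
  simp only [Matrix.smul_apply, Matrix.of_apply, smul_eq_mul]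
  rw [eq_inv_mul_iff_mul_eq₀ h0, h]
  simp only [Matrix.mul_apply, Matrix.of_apply, Matrix.transpose_apply, Finset.sum_mul]
  rw [Finset.sum_comm]
  refine Finset.sum_congr rfl fun i _ => Finset.sum_congr rfl fun j _ => ?_
  ring

lemma Hm_symm {η ηi : (Fin m → ℝ) → Fin m → Fin m → ℝ} (hη : IsMetric η ηi)
    (x : (Fin n → ℝ) → Fin m → ℝ) (p : Fin n → ℝ) : (Hm η x p).transpose = Hm η x p := by
  ext i j
  simp [Hm, hη.2.1 (x p) i j]

lemma gi_symm {η ηi : (Fin m → ℝ) → Fin m → Fin m → ℝ} (hη : IsMetric η ηi)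
    {x : (Fin n → ℝ) → Fin m → ℝ}
    {θ : (Fin n → ℝ) → Fin n → Fin n → ℝ} {γ2 : (Fin n → ℝ) → ℝ}
    {gi : (Fin n → ℝ) → Fin n → Fin n → ℝ} (hakp : IsAKP η x θ γ2 gi) (p : Fin n → ℝ) :
    (Matrix.of (gi p)).transpose = Matrix.of (gi p) := by
  rw [gi_eq hakp]
  simp only [Matrix.transpose_smul, Matrix.transpose_mul, Matrix.transpose_transpose, Hm_symm hη,
    Matrix.mul_assoc]

lemma gi_inv {η : (Fin m → ℝ) → Fin m → Fin m → ℝ}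
    {x : (Fin n → ℝ) → Fin m → ℝ}
    {θ : (Fin n → ℝ) → Fin n → Fin n → ℝ} {γ2 : (Fin n → ℝ) → ℝ}
    {gi : (Fin n → ℝ) → Fin n → Fin n → ℝ} (hakp : IsAKP η x θ γ2 gi) (p : Fin n → ℝ) :
    Matrix.of (gi p) * (em x p * Hm η x p * (em x p).transpose) = 1 := by
  rw [← ind_eq]
  apply mul_eq_one_comm.1
  ext a b
  rw [Matrix.mul_apply, Matrix.one_apply]
  exact hakp.2.2.2.2.2.2.1 p a b

lemma pbr_eq (θ : (Fin n → ℝ) → Fin n → Fin n → ℝ) (x : (Fin n → ℝ) → Fin m → ℝ)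
    (u : (Fin n → ℝ) → ℝ) (p : Fin n → ℝ) (k : Fin m) :
    pbr θ u (fun q => x q k) p
      = Matrix.vecMul (fun a => pd a u p) (Matrix.of (θ p) * em x p) k := by
  simp only [pbr, Matrix.vecMul, dotProduct, Matrix.mul_apply, em, Matrix.of_apply,
    Finset.mul_sum]
  refine Finset.sum_congr rfl fun i _ => Finset.sum_congr rfl fun j _ => ?_
  ring

lemma Dop_eq {η : (Fin m → ℝ) → Fin m → Fin m → ℝ}
    {x : (Fin n → ℝ) → Fin m → ℝ}
    {θ : (Fin n → ℝ) → Fin n → Fin n → ℝ} {γ2 : (Fin n → ℝ) → ℝ}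
    {gi : (Fin n → ℝ) → Fin n → Fin n → ℝ} (hakp : IsAKP η x θ γ2 gi)
    (u : (Fin n → ℝ) → ℝ) (p : Fin n → ℝ) (i : Fin m) :
    Dop η x θ γ2 u p i = ∑ a, ∑ c, gi p a c * pd a u p * pd c (fun q => x q i) p := by
  have h1 : ∑ a, ∑ c, gi p a c * pd a u p * pd c (fun q => x q i) p
      = dotProduct (fun a => pd a u p)
        (Matrix.mulVec (Matrix.of (gi p)) (fun c => pd c (fun q => x q i) p)) := by
    simp only [dotProduct, Matrix.mulVec, Matrix.of_apply, Finset.mul_sum]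
    refine Finset.sum_congr rfl fun i _ => Finset.sum_congr rfl fun j _ => ?_
    ring
  have h2 : ∀ v w : Fin m → ℝ, ∑ k, ∑ l, v k * w l * η (x p) k l
      = dotProduct v (Matrix.mulVec (Hm η x p) w) := by
    intro v w
    simp only [dotProduct, Matrix.mulVec, Hm, Matrix.of_apply, Finset.mul_sum]
    refine Finset.sum_congr rfl fun i _ => Finset.sum_congr rfl fun j _ => ?_
    ring
  rw [h1, gi_eq hakp]
  unfold Dop
  simp only [pbr_eq]
  rw [h2, Matrix.smul_mulVec, dotProduct_smul, smul_eq_mul]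
  congr 1
  rw [← Matrix.dotProduct_mulVec, ← Matrix.mulVec_transpose, Matrix.mulVec_mulVec,
    Matrix.mulVec_mulVec, Matrix.transpose_mul]
  simp only [Matrix.mul_assoc]

lemma Dmat_eq {η : (Fin m → ℝ) → Fin m → Fin m → ℝ}
    {x : (Fin n → ℝ) → Fin m → ℝ}
    {θ : (Fin n → ℝ) → Fin n → Fin n → ℝ} {γ2 : (Fin n → ℝ) → ℝ}
    {gi : (Fin n → ℝ) → Fin n → Fin n → ℝ} (hakp : IsAKP η x θ γ2 gi)
    (p : Fin n → ℝ) (i k : Fin m) :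
    Dmat η x θ γ2 p i k
      = ∑ a, ∑ c, gi p a c * pd a (fun q => x q k) p * pd c (fun q => x q i) p :=
  Dop_eq hakp _ p i

lemma PiL_eq {η ηi : (Fin m → ℝ) → Fin m → Fin m → ℝ} (hη : IsMetric η ηi)
    {x : (Fin n → ℝ) → Fin m → ℝ}
    {θ : (Fin n → ℝ) → Fin n → Fin n → ℝ} {γ2 : (Fin n → ℝ) → ℝ}
    {gi : (Fin n → ℝ) → Fin n → Fin n → ℝ} (hakp : IsAKP η x θ γ2 gi)
    (p : Fin n → ℝ) (i j : Fin m) :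
    PiL η x θ γ2 p i j = η (x p) i j - Em η x gi p i j := by
  have hD : Matrix.of (Dmat η x θ γ2 p) = (em x p).transpose * Matrix.of (gi p) * em x p := by
    ext i k
    have hg : ∀ a c, gi p a c = gi p c a := fun a c => (congrFun₂ (gi_symm hη hakp p) c a)
    simp only [Matrix.of_apply, Dmat_eq hakp, Matrix.mul_apply, Matrix.transpose_apply, em,
      Finset.sum_mul]
    refine Finset.sum_congr rfl fun a _ => Finset.sum_congr rfl fun c _ => ?_
    rw [hg a c]; ring
  have hE : Em η x gi p = Hm η x p * Matrix.of (Dmat η x θ γ2 p) * Hm η x p := by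
    rw [hD]; simp only [Em, Matrix.mul_assoc]
  rw [hE, PiL]
  congr 1
  simp only [Matrix.mul_apply, Matrix.of_apply, Hm, Finset.sum_mul]
  rw [Finset.sum_comm]
  refine Finset.sum_congr rfl fun a _ => Finset.sum_congr rfl fun c _ => ?_
  rw [hη.2.1 (x p) j a]; ring

lemma Dmat_contr {η : (Fin m → ℝ) → Fin m → Fin m → ℝ}
    {x : (Fin n → ℝ) → Fin m → ℝ}
    {θ : (Fin n → ℝ) → Fin n → Fin n → ℝ} {γ2 : (Fin n → ℝ) → ℝ}
    {gi : (Fin n → ℝ) → Fin n → Fin n → ℝ} (hakp : IsAKP η x θ γ2 gi)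
    (p : Fin n → ℝ) (i : Fin m) (G V : Fin m → Fin m → ℝ) :
    ∑ k, ∑ l, Dmat η x θ γ2 p i k * G k l * V k l
      = ∑ a, ∑ c, gi p a c * pd c (fun q => x q i) p *
        ∑ l, ∑ k, pd a (fun q => x q k) p * G k l * V k l := by
  have h : ∀ F : Fin m → ℝ, ∑ k, Dmat η x θ γ2 p i k * F k
      = ∑ a, ∑ c, gi p a c * pd c (fun q => x q i) p * ∑ k, pd a (fun q => x q k) p * F k := by
    intro F
    simp only [Dmat_eq hakp, Finset.sum_mul, Finset.mul_sum]
    rw [Finset.sum_comm]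
    refine Finset.sum_congr rfl fun a _ => ?_
    rw [Finset.sum_comm]
    refine Finset.sum_congr rfl fun c _ => Finset.sum_congr rfl fun k _ => ?_
    ring
  have h1 := h (fun k => ∑ l, G k l * V k l)
  simp only [Finset.mul_sum, ← mul_assoc] at h1
  rw [h1]
  refine Finset.sum_congr rfl fun a _ => Finset.sum_congr rfl fun c _ => ?_
  rw [Finset.sum_comm]
  simp only [Finset.mul_sum, ← mul_assoc]

lemma nhV_eq {η ηi : (Fin m → ℝ) → Fin m → Fin m → ℝ}
    {x : (Fin n → ℝ) → Fin m → ℝ}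
    {θ : (Fin n → ℝ) → Fin n → Fin n → ℝ} {γ2 : (Fin n → ℝ) → ℝ}
    {gi : (Fin n → ℝ) → Fin n → Fin n → ℝ} (hakp : IsAKP η x θ γ2 gi)
    (V : (Fin n → ℝ) → Fin m → ℝ) (p : Fin n → ℝ) (i j : Fin m) :
    nhV η ηi x θ γ2 V p i j = ∑ a, ∑ c, gi p a c * pd c (fun q => x q i) p *
      (pd a (fun q => V q j) p + ∑ l, Am η ηi x p a j l * V p l) := by
  rw [nhV, Dop_eq hakp, Dmat_contr hakp p i (fun k l => Chr η ηi (x p) j k l) (fun _ l => V p l)]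
  simp only [← Finset.sum_add_distrib]
  refine Finset.sum_congr rfl fun a _ => Finset.sum_congr rfl fun c _ => ?_
  simp only [Am, Matrix.of_apply, Finset.sum_mul]
  ring

lemma nhT02_eq {η ηi : (Fin m → ℝ) → Fin m → Fin m → ℝ}
    {x : (Fin n → ℝ) → Fin m → ℝ}
    {θ : (Fin n → ℝ) → Fin n → Fin n → ℝ} {γ2 : (Fin n → ℝ) → ℝ}
    {gi : (Fin n → ℝ) → Fin n → Fin n → ℝ} (hakp : IsAKP η x θ γ2 gi)
    (T : (Fin n → ℝ) → Fin m → Fin m → ℝ) (p : Fin n → ℝ) (i j k : Fin m) :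
    nhT02 η ηi x θ γ2 T p i j k = ∑ a, ∑ c, gi p a c * pd c (fun q => x q i) p *
      (pd a (fun q => T q j k) p - ∑ l, Am η ηi x p a l j * T p l k
        - ∑ l, Am η ηi x p a l k * T p j l) := by
  rw [nhT02, Dop_eq hakp,
    Dmat_contr hakp p i (fun l l' => Chr η ηi (x p) l' l j) (fun _ l' => T p l' k),
    Dmat_contr hakp p i (fun l l' => Chr η ηi (x p) l' l k) (fun _ l' => T p j l')]
  simp only [← Finset.sum_sub_distrib]
  refine Finset.sum_congr rfl fun a _ => Finset.sum_congr rfl fun c _ => ?_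
  simp only [Am, Matrix.of_apply, Finset.sum_mul]
  ring

/-- Metric compatibility of the Levi-Civita connection. -/
lemma metric_compat {k : ℕ} {g gi : (Fin k → ℝ) → Fin k → Fin k → ℝ} (hg : IsMetric g gi)
    (q : Fin k → ℝ) (c i j : Fin k) :
    pd c (fun r => g r i j) q
      = ∑ d, Chr g gi q d c i * g q d j + ∑ d, g q i d * Chr g gi q d c j := by
  obtain ⟨-, hs, -, hinv⟩ := hg
  have hs' : ∀ i j, (fun r => g r i j) = fun r => g r j i := fun i j => funext fun r => hs r i j
  have h : ∀ i c j, ∑ d, g q i d * Chr g gi q d c j = (1/2) *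
      (pd c (fun r => g r i j) q + pd j (fun r => g r i c) q - pd i (fun r => g r c j) q) := by
    intro i c j
    simp only [Chr, Finset.mul_sum]
    rw [Finset.sum_comm]
    have : ∀ e, ∑ d, g q i d * ((1/2) * (gi q d e *
        (pd c (fun r => g r e j) q + pd j (fun r => g r e c) q - pd e (fun r => g r c j) q)))
        = (if i = e then (1:ℝ) else 0) * ((1/2) *
        (pd c (fun r => g r e j) q + pd j (fun r => g r e c) q - pd e (fun r => g r c j) q)) := by
      intro e
      rw [← hinv q i e, Finset.sum_mul]
      refine Finset.sum_congr rfl fun d _ => ?_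
      ring
    simp only [this]
    simp
  have h' : ∑ d, Chr g gi q d c i * g q d j = ∑ d, g q j d * Chr g gi q d c i := by
    refine Finset.sum_congr rfl fun d _ => ?_
    rw [hs q d j, mul_comm]
  rw [h', h, h, hs' j i, hs' j c, hs' i c]
  ring

lemma Chr_symm {k : ℕ} {g gi : (Fin k → ℝ) → Fin k → Fin k → ℝ} (hg : IsMetric g gi)
    (q : Fin k → ℝ) (a b c : Fin k) : Chr g gi q a b c = Chr g gi q a c b := by
  obtain ⟨-, hs, -, -⟩ := hg
  unfold Chr
  congr 1
  refine Finset.sum_congr rfl fun d _ => ?_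
  rw [show (fun r => g r b c) = fun r => g r c b from funext fun r => hs r b c]
  ring

lemma smooth_diff {k : ℕ} {f : (Fin k → ℝ) → ℝ} (hf : ContDiff ℝ (⊤ : ℕ∞) f) (p : Fin k → ℝ) :
    DifferentiableAt ℝ f p :=
  (hf.differentiable (by simp)).differentiableAt

lemma smooth_eta {η ηi : (Fin m → ℝ) → Fin m → Fin m → ℝ} (hη : IsMetric η ηi)
    {x : (Fin n → ℝ) → Fin m → ℝ} (hx : SmoothEmb x) (i j : Fin m) :
    ContDiff ℝ (⊤ : ℕ∞) (fun q => η (x q) i j) :=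
  (hη.1 i j).comp (contDiff_pi.2 hx)

lemma smooth_E {η ηi : (Fin m → ℝ) → Fin m → Fin m → ℝ} (hη : IsMetric η ηi)
    {x : (Fin n → ℝ) → Fin m → ℝ} (hx : SmoothEmb x)
    {gi : (Fin n → ℝ) → Fin n → Fin n → ℝ} (hgi : Smooth2 gi) (i j : Fin m) :
    ContDiff ℝ (⊤ : ℕ∞) (fun q => Em η x gi q i j) := by
  simp only [Em, Matrix.mul_apply, Hm, em, Matrix.of_apply, Matrix.transpose_apply]
  have h1 := smooth_eta hη hx
  have h2 : ∀ a i, ContDiff ℝ (⊤ : ℕ∞) (fun q => pd a (fun q => x q i) q) :=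
    fun a i => pd_contDiff a (hx i)
  refine ContDiff.sum fun _ _ => ContDiff.mul (ContDiff.sum fun _ _ => ContDiff.mul
    (ContDiff.sum fun _ _ => ContDiff.mul (ContDiff.sum fun _ _ => ContDiff.mul ?_ ?_) ?_) ?_) ?_
  · exact h1 _ _
  · exact h2 _ _
  · exact hgi _ _
  · exact h2 _ _
  · exact h1 _ _

lemma dH_eq {η ηi : (Fin m → ℝ) → Fin m → Fin m → ℝ} (hη : IsMetric η ηi)
    {x : (Fin n → ℝ) → Fin m → ℝ} (hx : SmoothEmb x) (p : Fin n → ℝ) (a : Fin n) :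
    Matrix.of (fun i j => pd a (fun q => η (x q) i j) p)
      = (Am η ηi x p a).transpose * Hm η x p + Hm η x p * Am η ηi x p a := by
  ext i j
  rw [Matrix.of_apply, pd_comp' (h := fun r => η r i j) a (smooth_diff (hη.1 i j) _)
    (fun i => smooth_diff (hx i) p)]
  simp only [metric_compat hη, Matrix.add_apply, Matrix.mul_apply, Matrix.transpose_apply, Am, Hm,
    Matrix.of_apply, Finset.sum_mul, Finset.mul_sum, add_mul, Finset.sum_add_distrib]
  congr 1
  · rw [Finset.sum_comm]
    refine Finset.sum_congr rfl fun a _ => Finset.sum_congr rfl fun c _ => ?_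
    ring
  · rw [Finset.sum_comm]
    refine Finset.sum_congr rfl fun a _ => Finset.sum_congr rfl fun c _ => ?_
    ring

/-- `(∇̄_a V)^i` as a matrix. -/
noncomputable def Bm (η ηi : (Fin m → ℝ) → Fin m → Fin m → ℝ)
    (x : (Fin n → ℝ) → Fin m → ℝ) (V : (Fin n → ℝ) → Fin m → ℝ) (p : Fin n → ℝ) :
    Matrix (Fin n) (Fin m) ℝ :=
  Matrix.of fun a i => pd a (fun q => V q i) p + ∑ l, Am η ηi x p a i l * V p l

/-- `N^l (∇̄_a Π)_{il}` as a matrix. -/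
noncomputable def Wm (η ηi : (Fin m → ℝ) → Fin m → Fin m → ℝ)
    (x : (Fin n → ℝ) → Fin m → ℝ) (T : (Fin n → ℝ) → Fin m → Fin m → ℝ)
    (V : (Fin n → ℝ) → Fin m → ℝ) (p : Fin n → ℝ) :
    Matrix (Fin n) (Fin m) ℝ :=
  Matrix.of fun a i => ∑ l, V p l * (pd a (fun q => T q i l) p
    - ∑ l', Am η ηi x p a l' i * T p l' l - ∑ l', Am η ηi x p a l' l * T p i l')

lemma E_normal {η ηi : (Fin m → ℝ) → Fin m → Fin m → ℝ} (hη : IsMetric η ηi)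
    {x : (Fin n → ℝ) → Fin m → ℝ} (gi : (Fin n → ℝ) → Fin n → Fin n → ℝ)
    {V : (Fin n → ℝ) → Fin m → ℝ}
    (hV : ∀ p a, (∑ i, ∑ j, η (x p) i j * V p i * pd a (fun q => x q j) p) = 0)
    (p : Fin n → ℝ) : (Em η x gi p).mulVec (V p) = 0 := by
  have h : (em x p * Hm η x p).mulVec (V p) = 0 := by
    ext a
    rw [Pi.zero_apply, ← hV p a]
    simp only [Matrix.mulVec, dotProduct, Matrix.mul_apply, em, Hm, Matrix.of_apply,
      Finset.sum_mul]
    refine Finset.sum_congr rfl fun i _ => Finset.sum_congr rfl fun j _ => ?_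
    rw [hη.2.1 (x p) j i]; ring
  rw [Em, Matrix.mul_assoc _ (em x p), ← Matrix.mulVec_mulVec, h, Matrix.mulVec_zero]

lemma Wm_eq {η ηi : (Fin m → ℝ) → Fin m → Fin m → ℝ} (hη : IsMetric η ηi)
    {x : (Fin n → ℝ) → Fin m → ℝ} (hx : SmoothEmb x)
    {θ : (Fin n → ℝ) → Fin n → Fin n → ℝ} {γ2 : (Fin n → ℝ) → ℝ}
    {gi : (Fin n → ℝ) → Fin n → Fin n → ℝ} (hakp : IsAKP η x θ γ2 gi)
    {V : (Fin n → ℝ) → Fin m → ℝ} (hVs : ∀ i, ContDiff ℝ (⊤ : ℕ∞) fun q => V q i)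
    (hV : ∀ p a, (∑ i, ∑ j, η (x p) i j * V p i * pd a (fun q => x q j) p) = 0)
    (p : Fin n → ℝ) :
    Wm η ηi x (PiL η x θ γ2) V p = Bm η ηi x V p * Em η x gi p := by
  have hE := smooth_E hη hx hakp.2.2.2.1
  have hsym : (Em η x gi p).transpose = Em η x gi p := by
    simp only [Em, Matrix.transpose_mul, Matrix.transpose_transpose, Hm_symm hη,
      gi_symm hη hakp, Matrix.mul_assoc]
  ext a i
  have hn := E_normal hη gi hV
  have hdE : (Matrix.of fun i j => pd a (fun q => Em η x gi q i j) p).mulVec (V p)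
      = - (Em η x gi p).mulVec (fun i => pd a (fun q => V q i) p) := by
    ext i
    have h0 : (fun q => ∑ l, Em η x gi q i l * V q l) = fun _ => 0 :=
      funext fun q => congrFun (hn q) i
    have h1 : pd a (fun q => ∑ l, Em η x gi q i l * V q l) p = 0 := by
      rw [h0]; simp [pd]
    rw [pd_sum' a (fun l => (smooth_diff (hE i l) p).fun_mul (smooth_diff (hVs l) p))] at h1
    simp only [pd_mul' a (smooth_diff (hE i _) p) (smooth_diff (hVs _) p),
      Finset.sum_add_distrib] at h1
    simp only [Matrix.mulVec, dotProduct, Matrix.of_apply, Pi.neg_apply]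
    linarith
  have key := congrFun (alg_three _ _ _ _ _ _ _ (dH_eq hη hx p a) (hn p) hdE) i
  have hT : ∀ i j, pd a (fun q => PiL η x θ γ2 q i j) p
      = pd a (fun q => η (x q) i j) p - pd a (fun q => Em η x gi q i j) p := by
    intro i j
    simp only [PiL_eq hη hakp]
    exact pd_sub' a (smooth_diff (smooth_eta hη hx i j) p) (smooth_diff (hE i j) p)
  have hL : Wm η ηi x (PiL η x θ γ2) V p a i = ((Matrix.of (fun i j => pd a (fun q => η (x q) i j) p)
      - (Matrix.of fun i j => pd a (fun q => Em η x gi q i j) p)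
      - (Am η ηi x p a).transpose * (Hm η x p - Em η x gi p)
      - (Hm η x p - Em η x gi p) * Am η ηi x p a).mulVec (V p)) i := by
    simp only [Wm, Matrix.of_apply, hT]
    simp only [Matrix.of_apply, Matrix.mulVec, dotProduct, Matrix.sub_apply,
      Matrix.mul_apply, Matrix.transpose_apply, PiL_eq hη hakp, Hm]
    refine Finset.sum_congr rfl fun l _ => ?_
    rw [mul_comm]
    congr 2
    refine Finset.sum_congr rfl fun l' _ => ?_
    ring
  rw [hL, key, Matrix.mul_apply]
  simp only [Matrix.mulVec, dotProduct]
  refine Finset.sum_congr rfl fun l _ => ?_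
  have : Em η x gi p i l = Em η x gi p l i := congrFun₂ hsym l i
  rw [this, mul_comm]
  simp [Bm, Matrix.mulVec, dotProduct]

lemma S_symm {η ηi : (Fin m → ℝ) → Fin m → Fin m → ℝ} (hη : IsMetric η ηi)
    {x : (Fin n → ℝ) → Fin m → ℝ} (hx : SmoothEmb x)
    {V : (Fin n → ℝ) → Fin m → ℝ} (hVs : ∀ i, ContDiff ℝ (⊤ : ℕ∞) fun q => V q i)
    (hV : ∀ p a, (∑ i, ∑ j, η (x p) i j * V p i * pd a (fun q => x q j) p) = 0)
    (p : Fin n → ℝ) :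
    (Bm η ηi x V p * Hm η x p * (em x p).transpose).transpose
      = Bm η ηi x V p * Hm η x p * (em x p).transpose := by
  have hS : ∀ a c, (Bm η ηi x V p * Hm η x p * (em x p).transpose) a c
      = - ∑ i, ∑ j, η (x p) i j * V p i * (pd a (pd c (fun q => x q j)) p
        + ∑ l, Am η ηi x p a j l * pd c (fun q => x q l) p) := by
    intro a c
    have h1 : pd a (fun q => ∑ i, ∑ j, η (x q) i j * V q i * pd c (fun q => x q j) q) p = 0 := by
      simp only [hV]; simp [pd]
    have d1 := fun i j => smooth_diff (smooth_eta hη hx i j) p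
    have d2 := fun i => smooth_diff (hVs i) p
    have d3 := fun j => smooth_diff (pd_contDiff c (hx j)) p
    have d12 := fun i j => (d1 i j).fun_mul (d2 i)
    have d123 := fun i j => (d12 i j).fun_mul (d3 j)
    have h2 : pd a (fun q => ∑ i, ∑ j, η (x q) i j * V q i * pd c (fun q => x q j) q) p
        = ∑ i, ∑ j, ((pd a (fun q => η (x q) i j) p * V p i
          + η (x p) i j * pd a (fun q => V q i) p) * pd c (fun q => x q j) p
          + η (x p) i j * V p i * pd a (pd c (fun q => x q j)) p) := by
      rw [pd_sum' a (fun i => DifferentiableAt.fun_sum fun j _ => d123 i j)]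
      refine Finset.sum_congr rfl fun i _ => ?_
      rw [pd_sum' a (fun j => d123 i j)]
      refine Finset.sum_congr rfl fun j _ => ?_
      rw [← pd_mul' a (d1 i j) (d2 i), ← pd_mul' a (d12 i j) (d3 j)]
    have h3 : ∀ i j, pd a (fun q => η (x q) i j) p = ∑ l, Am η ηi x p a l i * η (x p) l j
        + ∑ l, η (x p) i l * Am η ηi x p a l j := by
      intro i j
      have := congrFun₂ (dH_eq hη hx p a) i j
      simpa [Matrix.mul_apply, Hm] using this
    -- the two connection terms
    have h4 : ∑ i, ∑ j, (∑ l, Am η ηi x p a l i * η (x p) l j) * V p i * pd c (fun q => x q j) p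
        = ∑ i, ∑ j, η (x p) i j * (∑ l, Am η ηi x p a i l * V p l) * pd c (fun q => x q j) p := by
      rw [Finset.sum_comm]
      rw [Finset.sum_comm (f := fun i j => η (x p) i j * (∑ l, Am η ηi x p a i l * V p l)
        * pd c (fun q => x q j) p)]
      refine Finset.sum_congr rfl fun j _ => ?_
      simp only [Finset.mul_sum, Finset.sum_mul]
      rw [Finset.sum_comm]
      refine Finset.sum_congr rfl fun a _ => Finset.sum_congr rfl fun c _ => ?_
      ring
    have h5 : ∑ i, ∑ j, (∑ l, η (x p) i l * Am η ηi x p a l j) * V p i * pd c (fun q => x q j) p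
        = ∑ i, ∑ j, η (x p) i j * V p i * (∑ l, Am η ηi x p a j l * pd c (fun q => x q l) p) := by
      refine Finset.sum_congr rfl fun i _ => ?_
      simp only [Finset.mul_sum, Finset.sum_mul]
      rw [Finset.sum_comm]
      refine Finset.sum_congr rfl fun a _ => Finset.sum_congr rfl fun c _ => ?_
      ring
    have h6 : (Bm η ηi x V p * Hm η x p * (em x p).transpose) a c
        = ∑ i, ∑ j, η (x p) i j * pd a (fun q => V q i) p * pd c (fun q => x q j) p
        + ∑ i, ∑ j, η (x p) i j * (∑ l, Am η ηi x p a i l * V p l) * pd c (fun q => x q j) p := by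
      simp only [Matrix.mul_apply, Bm, Hm, em, Matrix.of_apply, Matrix.transpose_apply]
      simp only [← Finset.sum_add_distrib]
      rw [Finset.sum_comm]
      refine Finset.sum_congr rfl fun j _ => ?_
      rw [Finset.sum_mul]
      refine Finset.sum_congr rfl fun i _ => ?_
      ring
    rw [h2] at h1
    simp only [h3, add_mul, Finset.sum_add_distrib] at h1
    rw [h4, h5] at h1
    rw [h6]
    simp only [mul_add, Finset.sum_add_distrib]
    linarith
  ext a c
  rw [Matrix.transpose_apply, hS, hS]
  congr 1
  refine Finset.sum_congr rfl fun i _ => Finset.sum_congr rfl fun j _ => ?_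
  rw [pd_comm' c a p (hx j)]
  congr 2
  simp only [Am, Matrix.of_apply, Finset.sum_mul]
  rw [Finset.sum_comm]
  refine Finset.sum_congr rfl fun i _ => Finset.sum_congr rfl fun l _ => ?_
  rw [Chr_symm hη]
  ring

/-- For every tangent `X` : `(∇̂_i N_A^k) X_k = N_A^l (∇̂^k Π_{il}) X_k`,
and consequently `∇̂_k N_A^k = N_A^l (∇̂^i Π_{il})`. -/
theorem statement_5 {n m r : ℕ}
    (η ηi : (Fin m → ℝ) → Fin m → Fin m → ℝ) (x : (Fin n → ℝ) → Fin m → ℝ)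
    (θ : (Fin n → ℝ) → Fin n → Fin n → ℝ) (γ2 : (Fin n → ℝ) → ℝ)
    (gi : (Fin n → ℝ) → Fin n → Fin n → ℝ)
    (N : Fin r → (Fin n → ℝ) → Fin m → ℝ)
    (hη : IsMetric η ηi) (hx : SmoothEmb x) (hakp : IsAKP η x θ γ2 gi)
    (hN : NormalFrame η ηi x θ γ2 N) :
    (∀ (A : Fin r) (p : Fin n → ℝ) (c : (Fin n → ℝ) → Fin n → ℝ) (i : Fin m),
      (∑ k, (∑ j, η (x p) i j * nhV η ηi x θ γ2 (N A) p j k) * low η x (tv x c) p k)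
        = ∑ k, ∑ l, N A p l
            * nhT02 η ηi x θ γ2 (fun q => PiL η x θ γ2 q) p k i l
            * low η x (tv x c) p k) ∧
    (∀ (A : Fin r) (p : Fin n → ℝ),
      (∑ k, ∑ j, η (x p) k j * nhV η ηi x θ γ2 (N A) p j k)
        = ∑ l, N A p l * ∑ i, nhT02 η ηi x θ γ2 (fun q => PiL η x θ γ2 q) p i i l) := by
  have hA : ∀ A, (∀ i, ContDiff ℝ (⊤ : ℕ∞) fun q => N A q i) ∧
      (∀ p a, (∑ i, ∑ j, η (x p) i j * N A p i * pd a (fun q => x q j) p) = 0) :=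
    fun A => ⟨hN.1 A, hN.2.2.1 A⟩
  have hg : ∀ p a c, gi p a c = gi p c a := fun p a c => congrFun₂ (gi_symm hη hakp p) c a
  have hnV : ∀ A p j k, nhV η ηi x θ γ2 (N A) p j k
      = ((em x p).transpose * Matrix.of (gi p) * Bm η ηi x (N A) p) j k := by
    intro A p j k
    rw [nhV_eq hakp]
    simp only [Matrix.mul_apply, Matrix.transpose_apply, em, Bm, Matrix.of_apply, Finset.sum_mul]
    refine Finset.sum_congr rfl fun a _ => Finset.sum_congr rfl fun c _ => ?_
    rw [hg p a c]; ring
  have hnT : ∀ A p k i, ∑ l, N A p l * nhT02 η ηi x θ γ2 (fun q => PiL η x θ γ2 q) p k i l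
      = ((em x p).transpose * Matrix.of (gi p) * Wm η ηi x (PiL η x θ γ2) (N A) p) k i := by
    intro A p k i
    simp only [nhT02_eq hakp, Matrix.mul_apply, Matrix.transpose_apply, em, Wm, Matrix.of_apply,
      Finset.sum_mul]
    simp only [Finset.mul_sum (s := Finset.univ (α := Fin n))]
    rw [Finset.sum_comm]
    refine Finset.sum_congr rfl fun a _ => ?_
    rw [Finset.sum_comm]
    refine Finset.sum_congr rfl fun c _ => ?_
    rw [Finset.mul_sum]
    refine Finset.sum_congr rfl fun l _ => ?_
    rw [hg p a c]; ring
  have hW := fun A p => Wm_eq hη hx hakp (hA A).1 (hA A).2 p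
  refine ⟨?_, ?_⟩
  · intro A p c i
    have hlow : low η x (tv x c) p = (Hm η x p * (em x p).transpose).mulVec (c p) := by
      ext k
      rw [← Matrix.mulVec_mulVec]
      simp only [low, tv, Matrix.mulVec, dotProduct, Hm, em, Matrix.of_apply,
        Matrix.transpose_apply]
      refine Finset.sum_congr rfl fun j _ => ?_
      congr 1
      exact Finset.sum_congr rfl fun a _ => mul_comm _ _
    have hL : (∑ k, (∑ j, η (x p) i j * nhV η ηi x θ γ2 (N A) p j k) * low η x (tv x c) p k)
        = (Hm η x p * ((em x p).transpose * Matrix.of (gi p)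
          * Bm η ηi x (N A) p)).mulVec (low η x (tv x c) p) i := by
      simp only [hnV, Matrix.mulVec, dotProduct]
      rfl
    have hR : (∑ k, ∑ l, N A p l * nhT02 η ηi x θ γ2 (fun q => PiL η x θ γ2 q) p k i l
            * low η x (tv x c) p k)
        = ((em x p).transpose * Matrix.of (gi p)
          * Wm η ηi x (PiL η x θ γ2) (N A) p).transpose.mulVec (low η x (tv x c) p) i := by
      simp only [← Finset.sum_mul, hnT, Matrix.mulVec, dotProduct, Matrix.transpose_apply]
    have key := alg_one _ _ _ _ _ (Hm_symm hη x p) (gi_symm hη hakp p) (gi_inv hakp p)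
      (S_symm hη hx (hA A).1 (hA A).2 p) (hW A p)
    rw [hL, hR, hlow, Matrix.mulVec_mulVec, Matrix.mulVec_mulVec]
    refine congrFun (congrArg (fun M : Matrix (Fin m) (Fin n) ℝ => M.mulVec (c p)) ?_) i
    simp only [Matrix.transpose_mul, Matrix.transpose_transpose, gi_symm hη hakp]
    simp only [Matrix.mul_assoc] at key ⊢
    exact key
  · intro A p
    have key := alg_two _ _ _ _ _ (gi_inv hakp p) (hW A p)
    have hL : (∑ k, ∑ j, η (x p) k j * nhV η ηi x θ γ2 (N A) p j k)
        = (Hm η x p * (em x p).transpose * Matrix.of (gi p) * Bm η ηi x (N A) p).trace := by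
      rw [Matrix.mul_assoc, Matrix.mul_assoc, ← Matrix.mul_assoc (em x p).transpose]
      simp only [hnV]
      rfl
    rw [hL, key]
    simp only [Finset.mul_sum]
    rw [Finset.sum_comm]
    simp only [hnT]
    rfl

end KP
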